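/- arXiv:1502.03579 — 3 statements merged into one kernel-verified Lean document; each statement's English description precedes it below -/
import Mathlib

section
/- For k ∈ {1,2,3}, let Γ′ ⊆ ℤ³ be a G_k-prebrick. Then Γ := φ_k⁻¹(Γ′) = { m ∈ ℤ³ : φ_k(m) ∈ Γ′ } is a G-prebrick with respect to the modulus r and the weights (1, a, r−a). -/
noncomputable section

open Classical

/-- The lattice `ℤ³` of exponents of Laurent monomials in `x, y, z` (written additively). -/
abbrev V3 : Type := Fin 3 → ℤ

/-- The standard basis vectors `e₁, e₂, e₃` (indices `0, 1, 2`). -/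
def ee (i : Fin 3) : V3 := Pi.single i 1

/-- `n` is a genuine monomial, i.e. `n ∈ ℕ³ ⊆ ℤ³`. -/
def IsNat3 (n : V3) : Prop := ∀ i, 0 ≤ n i

/-- The weight map `w(m) = β₁m₁ + β₂m₂ + β₃m₃ (mod s)`. -/
def wmap (s : ℕ) (β : Fin 3 → ℤ) (m : V3) : ZMod s := ((∑ i, β i * m i : ℤ) : ZMod s)

/-- One step of a (fractional) monomial path inside `Γ`: multiply or divide
by one of `x, y, z`, staying in `Γ`. -/
def StepRel (Γ : Set V3) (m m' : V3) : Prop :=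
  m' ∈ Γ ∧ ∃ i : Fin 3, m' = m + ee i ∨ m' = m - ee i

/-- A prebrick with respect to the modulus `s` and the weights `β`. -/
structure IsPrebrick (s : ℕ) (β : Fin 3 → ℤ) (Γ : Set V3) : Prop where
  zero_mem : (0 : V3) ∈ Γ
  bijOn : Set.BijOn (wmap s β) Γ Set.univ
  saturated : ∀ m ∈ Γ, ∀ n n' : V3, IsNat3 n → IsNat3 n' → n' + n + m ∈ Γ → n + m ∈ Γ
  connected : ∀ m ∈ Γ, Relation.ReflTransGen (StepRel Γ) m 0

/-- `wtG s β Γ m` is the unique element of `Γ` with the same weight as `m`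
(when `Γ` is a prebrick). -/
noncomputable def wtG (s : ℕ) (β : Fin 3 → ℤ) (Γ : Set V3) (m : V3) : V3 :=
  Classical.epsilon fun g => g ∈ Γ ∧ wmap s β g = wmap s β m

/-- The monoid `S(Γ)`, generated by all `n + m − wt_Γ(n + m)`, `n ∈ ℕ³`, `m ∈ Γ`. -/
def SG (s : ℕ) (β : Fin 3 → ℤ) (Γ : Set V3) : AddSubmonoid V3 :=
  AddSubmonoid.closure
    {v | ∃ n m : V3, IsNat3 n ∧ m ∈ Γ ∧ v = n + m - wtG s β Γ (n + m)}

/-- A brick: a prebrick with `S(Γ) ∩ (−S(Γ)) = {0}`. -/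
def IsBrick (s : ℕ) (β : Fin 3 → ℤ) (Γ : Set V3) : Prop :=
  IsPrebrick s β Γ ∧ ∀ v ∈ SG s β Γ, -v ∈ SG s β Γ → v = 0

/-- `d(m) = m₁ + a·m₂ + (r−a)·m₃`. -/
def dd (r a : ℕ) (m : V3) : ℤ := m 0 + (a : ℤ) * m 1 + ((r : ℤ) - (a : ℤ)) * m 2

/-- The round down functions of the weighted blowup with weight `(1, a, r−a)`:
`phiRD r a 0 = φ₁` (central), `phiRD r a 1 = φ₂` (left), `phiRD r a 2 = φ₃` (right);
the `k`-th coordinate is replaced by `⌊d(m)/r⌋`. -/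
def phiRD (r a : ℕ) (k : Fin 3) (m : V3) : V3 :=
  Function.update m k ((dd r a m).fdiv (r : ℤ))

/-- Weights `(1, a, r−a)` of the group `G` of type `(1/r)(1, a, r−a)`. -/
def wtsG (r a : ℕ) : Fin 3 → ℤ := ![1, (a : ℤ), (r : ℤ) - (a : ℤ)]

/-- Moduli of the groups `G₁` (trivial), `G₂` of type `(1/a)(1,−r,r)` and
`G₃` of type `(1/(r−a))(1,r,−r)`. -/
def gkMod (r a : ℕ) : Fin 3 → ℕ := ![1, a, r - a]

/-- Weights of the groups `G₁, G₂, G₃`. -/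
def gkWts (r a : ℕ) : Fin 3 → Fin 3 → ℤ :=
  ![![0, 0, 0], ![1, -(r : ℤ), (r : ℤ)], ![1, (r : ℤ), -(r : ℤ)]]

theorem dd_eq_sum (r a : ℕ) (m : V3) : dd r a m = ∑ i, wtsG r a i * m i := by
  simp [dd, wtsG, Fin.sum_univ_three]

theorem dd_zero (r a : ℕ) : dd r a 0 = 0 := by simp [dd]

theorem dd_add (r a : ℕ) (m n : V3) : dd r a (m + n) = dd r a m + dd r a n := by
  simp only [dd, Pi.add_apply]; ring

theorem dd_ee (r a : ℕ) (i : Fin 3) : dd r a (ee i) = wtsG r a i := by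
  fin_cases i <;> simp [dd, ee, wtsG]

theorem dd_update (r a : ℕ) (k : Fin 3) (u : V3) (t : ℤ) :
    dd r a (Function.update u k t) = dd r a u + wtsG r a k * (t - u k) := by
  fin_cases k <;> simp [dd, wtsG, Function.update] <;> ring

theorem wtsG_pos {r a : ℕ} (h1 : 0 < a) (h2 : a < r) (i : Fin 3) : 0 < wtsG r a i := by
  fin_cases i <;> simp [wtsG] <;> omega

theorem wtsG_le {r a : ℕ} (h1 : 0 < a) (h2 : a < r) (i : Fin 3) : wtsG r a i ≤ r := by
  fin_cases i <;> simp [wtsG] <;> omega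

theorem wtsG_add_le {r a : ℕ} (h1 : 0 < a) (h2 : a < r) {i j : Fin 3} (hij : i ≠ j) :
    wtsG r a i + wtsG r a j ≤ r := by
  fin_cases i <;> fin_cases j <;> simp [wtsG] at hij ⊢ <;> omega

theorem gkMod_cast {r a : ℕ} (h2 : a < r) (k : Fin 3) : (gkMod r a k : ℤ) = wtsG r a k := by
  fin_cases k <;> simp [gkMod, wtsG]
  omega

theorem dd_nonneg {r a : ℕ} (h2 : a < r) {n : V3} (hn : IsNat3 n) : 0 ≤ dd r a n := by
  have h0 := hn 0
  have hy := mul_nonneg (Int.natCast_nonneg a) (hn 1)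
  have hz : 0 ≤ ((r : ℤ) - a) * n 2 := mul_nonneg (by omega) (hn 2)
  unfold dd
  linarith

/-- The weight of `G_k` agrees with `d(u) - r·u_k` modulo the order of `G_k`. -/
theorem dvd_gkWts_sub (r a : ℕ) (k : Fin 3) (u : V3) :
    wtsG r a k ∣ (∑ i, gkWts r a k i * u i) - (dd r a u - r * u k) := by
  fin_cases k
  · simp [wtsG]
  · exact ⟨u 2 - u 1, by simp [wtsG, gkWts, dd, Fin.sum_univ_three]; ring⟩
  · exact ⟨u 1 - u 2, by simp [wtsG, gkWts, dd, Fin.sum_univ_three]; ring⟩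

theorem wmap_eq_iff (s : ℕ) (β : Fin 3 → ℤ) (m : V3) (x : ℤ) :
    wmap s β m = (x : ZMod s) ↔ (s : ℤ) ∣ (∑ i, β i * m i) - x := by
  rw [wmap, eq_comm, ZMod.intCast_eq_intCast_iff_dvd_sub]

theorem phiRD_eq_iff {r a : ℕ} (hr : 0 < r) (k : Fin 3) (m u : V3) :
    phiRD r a k m = u ↔
      (∀ i, i ≠ k → m i = u i) ∧ r * u k ≤ dd r a m ∧ dd r a m < r * u k + r := by
  have hr' : (0 : ℤ) < r := by exact_mod_cast hr
  have hdiv : (dd r a m).fdiv r = u k ↔ r * u k ≤ dd r a m ∧ dd r a m < r * u k + r := by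
    rw [Int.fdiv_eq_ediv_of_nonneg _ hr'.le, Int.ediv_eq_iff_of_pos hr']
    constructor <;> rintro ⟨h, h'⟩ <;> constructor <;> linarith
  rw [← hdiv, phiRD, Function.update_eq_iff]
  tauto

theorem phiRD_zero (r a : ℕ) (k : Fin 3) : phiRD r a k 0 = 0 := by
  simp [phiRD, dd_zero]

theorem phiRD_mono {r a : ℕ} (h2 : a < r) (k : Fin 3) {n : V3} (hn : IsNat3 n) (m : V3) :
    IsNat3 (phiRD r a k (n + m) - phiRD r a k m) := by
  intro i
  rcases eq_or_ne i k with rfl | hik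
  · have hr' : (0 : ℤ) ≤ r := Int.natCast_nonneg r
    have hd := dd_nonneg h2 hn
    simp only [phiRD, Pi.sub_apply, Function.update_self, dd_add, sub_nonneg,
      Int.fdiv_eq_ediv_of_nonneg _ hr']
    exact Int.ediv_le_ediv (by omega) (by linarith)
  · simpa [phiRD, hik] using hn i

theorem exists_mul_add_mem_Ico {c : ℤ} (hc : 0 < c) (e x : ℤ) :
    ∃ t, x ≤ e + c * t ∧ e + c * t < x + c := by
  refine ⟨-((e - x) / c), ?_⟩
  have h := Int.emod_add_mul_ediv (e - x) c
  have h0 := Int.emod_nonneg (e - x) hc.ne'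
  have hlt := Int.emod_lt_of_pos (e - x) hc
  constructor <;> linarith

/-- Neighbouring points of `ℤ³` have neighbouring preimages under `φ_k`. -/
theorem exists_phiRD_step {r a : ℕ} (h1 : 0 < a) (h2 : a < r) (k i : Fin 3) (u : V3) :
    ∃ m, phiRD r a k m = u ∧ phiRD r a k (m + ee i) = u + ee i := by
  have hr : 0 < r := by omega
  have hk := wtsG_pos h1 h2 k
  have hi := wtsG_pos h1 h2 i
  have hkr := wtsG_le h1 h2 k
  have key : ∀ x : ℤ, ∃ m : V3, (∀ j, j ≠ k → m j = u j) ∧ x ≤ dd r a m ∧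
      dd r a m < x + wtsG r a k := by
    intro x
    obtain ⟨t, ht⟩ := exists_mul_add_mem_Ico hk (dd r a u) x
    refine ⟨Function.update u k (u k + t), fun j hj => by simp [hj], ?_⟩
    simpa [dd_update] using ht
  simp only [phiRD_eq_iff hr, dd_add, dd_ee]
  rcases eq_or_ne i k with rfl | hik
  · obtain ⟨m, hm, hlo, hhi⟩ := key (r * u i + r - wtsG r a i)
    refine ⟨m, ⟨hm, by linarith, by linarith⟩, fun j hj => by simp [hm j hj], ?_⟩
    simp only [Pi.add_apply, ee, Pi.single_eq_same]
    constructor <;> linarith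
  · obtain ⟨m, hm, hlo, hhi⟩ := key (r * u k)
    have hsum := wtsG_add_le h1 h2 hik
    refine ⟨m, ⟨hm, hlo, by linarith⟩, fun j hj => by simp [hm j hj], ?_⟩
    simp only [Pi.add_apply, ee, Pi.single_eq_of_ne hik.symm]
    constructor <;> linarith

theorem stepRel_symm {Γ : Set V3} {m m' : V3} (hm : m ∈ Γ) (h : StepRel Γ m m') :
    StepRel Γ m' m := by
  obtain ⟨_, i, rfl | rfl⟩ := h
  · exact ⟨hm, i, Or.inr (by simp)⟩
  · exact ⟨hm, i, Or.inl (by simp)⟩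

/-- Each fibre of `φ_k` over `Γ'` is a connected string in the direction `e_k`. -/
theorem fibre_connected_of_le {r a : ℕ} (h1 : 0 < a) (h2 : a < r) (k : Fin 3) {Γ' : Set V3}
    {u : V3} (hu : u ∈ Γ') (t : ℕ) : ∀ m, phiRD r a k m = u →
      phiRD r a k (m + t • ee k) = u →
      Relation.ReflTransGen (StepRel (phiRD r a k ⁻¹' Γ')) m (m + t • ee k) ∧
      Relation.ReflTransGen (StepRel (phiRD r a k ⁻¹' Γ')) (m + t • ee k) m := by
  have hr : 0 < r := by omega
  have hk := wtsG_pos h1 h2 k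
  induction t with
  | zero => intro m _ _; simp [Relation.ReflTransGen.refl]
  | succ t ih =>
    intro m hm hm'
    have hassoc : m + (t + 1) • ee k = m + ee k + t • ee k := by
      rw [add_smul, one_smul]; abel
    rw [hassoc] at hm' ⊢
    have hmid : phiRD r a k (m + ee k) = u := by
      have hlo := ((phiRD_eq_iff hr k _ _).1 hm).2.1
      have hhi := ((phiRD_eq_iff hr k _ _).1 hm').2.2
      have hnn : 0 ≤ dd r a (t • ee k) := dd_nonneg h2 fun i => by
        by_cases h : i = k
        · subst h; simp [ee]
        · simp [ee, h]
      rw [dd_add] at hhi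
      refine (phiRD_eq_iff hr k _ _).2 ⟨fun i hi => ?_, ?_, by linarith⟩
      · simpa [ee, hi] using ((phiRD_eq_iff hr k _ _).1 hm).1 i hi
      · rw [dd_add, dd_ee]; linarith
    have hmem : m ∈ phiRD r a k ⁻¹' Γ' := by simpa [hm] using hu
    have hstep : StepRel (phiRD r a k ⁻¹' Γ') m (m + ee k) :=
      ⟨by simpa [hmid] using hu, k, Or.inl rfl⟩
    obtain ⟨hto, hfrom⟩ := ih _ hmid hm'
    exact ⟨hto.head hstep, hfrom.tail (stepRel_symm hmem hstep)⟩

theorem fibre_connected {r a : ℕ} (h1 : 0 < a) (h2 : a < r) (k : Fin 3) {Γ' : Set V3}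
    {u : V3} (hu : u ∈ Γ') {m m' : V3} (hm : phiRD r a k m = u) (hm' : phiRD r a k m' = u) :
    Relation.ReflTransGen (StepRel (phiRD r a k ⁻¹' Γ')) m m' := by
  have hr : 0 < r := by omega
  have key : ∀ p q : V3, phiRD r a k p = u → phiRD r a k q = u → p k ≤ q k →
      q = p + (q k - p k).toNat • ee k := by
    intro p q hp hq hle
    ext i
    by_cases hi : i = k
    · subst hi
      simp [ee, hle]
    · have hpi := ((phiRD_eq_iff hr k _ _).1 hp).1 i hi
      have hqi := ((phiRD_eq_iff hr k _ _).1 hq).1 i hi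
      simp [ee, hi, hpi, hqi]
  rcases le_total (m k) (m' k) with h | h
  · have heq := key m m' hm hm' h
    rw [heq] at hm' ⊢
    exact (fibre_connected_of_le h1 h2 k hu _ m hm hm').1
  · have heq := key m' m hm' hm h
    rw [heq] at hm ⊢
    exact (fibre_connected_of_le h1 h2 k hu _ m' hm' hm).2

theorem preimage_connected {r a : ℕ} (h1 : 0 < a) (h2 : a < r) (k : Fin 3) {Γ' : Set V3}
    {u : V3} (hu : u ∈ Γ') (hpath : Relation.ReflTransGen (StepRel Γ') u 0) :
    ∀ m, phiRD r a k m = u → Relation.ReflTransGen (StepRel (phiRD r a k ⁻¹' Γ')) m 0 := by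
  induction hpath using Relation.ReflTransGen.head_induction_on with
  | refl => exact fun m hm => fibre_connected h1 h2 k hu hm (phiRD_zero r a k)
  | head hstep _ ih =>
    rename_i v w _
    intro m hm
    obtain ⟨hw, i, hwi⟩ := hstep
    have hlift : ∃ p q, phiRD r a k p = v ∧ phiRD r a k q = w ∧ (q = p + ee i ∨ q = p - ee i) := by
      rcases hwi with rfl | rfl
      · obtain ⟨p, hp, hq⟩ := exists_phiRD_step h1 h2 k i v
        exact ⟨p, _, hp, hq, Or.inl rfl⟩
      · obtain ⟨p, hp, hq⟩ := exists_phiRD_step h1 h2 k i (v - ee i)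
        exact ⟨p + ee i, p, by simpa using hq, hp, Or.inr (by simp)⟩
    obtain ⟨p, q, hp, hq, hpq⟩ := hlift
    exact (fibre_connected h1 h2 k hu hm hp).trans
      ((ih hw q hq).head ⟨by simpa [hq] using hw, i, hpq⟩)

/-- The weight of `φ_k(m)` in `G_k` is the residue of `d(m)` modulo `r`. -/
theorem wmap_phiRD {r a : ℕ} (h2 : a < r) (k : Fin 3) (m : V3) :
    wmap (gkMod r a k) (gkWts r a k) (phiRD r a k m) = ((dd r a m % r : ℤ) : ZMod _) := by
  rw [wmap_eq_iff, gkMod_cast h2]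
  obtain ⟨q, hq⟩ := dvd_gkWts_sub r a k (phiRD r a k m)
  have hd : dd r a (phiRD r a k m) = dd r a m + wtsG r a k * ((dd r a m).fdiv r - m k) :=
    dd_update ..
  have hkk : phiRD r a k m k = dd r a m / r := by
    simp [phiRD, Int.fdiv_eq_ediv_of_nonneg]
  have hmod := Int.emod_add_mul_ediv (dd r a m) r
  rw [hd, hkk] at hq
  exact ⟨q + ((dd r a m).fdiv r - m k), by linear_combination hq - hmod⟩

theorem bijOn_preimage {r a : ℕ} (h1 : 0 < a) (h2 : a < r) (k : Fin 3) {Γ' : Set V3}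
    (h' : Set.BijOn (wmap (gkMod r a k) (gkWts r a k)) Γ' Set.univ) :
    Set.BijOn (wmap r (wtsG r a)) (phiRD r a k ⁻¹' Γ') Set.univ := by
  have hr : 0 < r := by omega
  have hr' : (0 : ℤ) < r := by exact_mod_cast hr
  have hw : ∀ m, wmap r (wtsG r a) m = (dd r a m : ZMod r) := fun m => by rw [wmap, dd_eq_sum]
  refine ⟨fun _ _ => Set.mem_univ _, fun m hm m' hm' h => ?_, fun z _ => ?_⟩
  · have hmod : dd r a m % r = dd r a m' % r := by
      rw [hw, hw] at h
      exact (ZMod.intCast_eq_intCast_iff' _ _ _).1 h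
    have hphi : phiRD r a k m = phiRD r a k m' :=
      h'.injOn hm hm' (by rw [wmap_phiRD h2, wmap_phiRD h2, hmod])
    have hne : ∀ i, i ≠ k → m i = m' i := fun i hi => by
      simpa [phiRD, hi] using congrFun hphi i
    have hdiv : dd r a m / r = dd r a m' / r := by
      simpa [phiRD, Int.fdiv_eq_ediv_of_nonneg] using congrFun hphi k
    have hdd : dd r a m = dd r a m' := by
      rw [← Int.emod_add_mul_ediv (dd r a m) r, hmod, hdiv, Int.emod_add_mul_ediv]
    have hupd : m = Function.update m' k (m k) :=
      Function.eq_update_iff.2 ⟨rfl, hne⟩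
    rw [hupd, dd_update] at hdd
    have hk : wtsG r a k ≠ 0 := (wtsG_pos h1 h2 k).ne'
    have hmk : m k = m' k := by
      have := (mul_eq_zero.1 (by linarith : wtsG r a k * (m k - m' k) = 0)).resolve_left hk
      linarith
    rw [hupd, hmk, Function.update_eq_self]
  · obtain ⟨x, rfl⟩ := ZMod.intCast_surjective z
    obtain ⟨u, hu, hux⟩ := h'.surjOn (Set.mem_univ ((x % r : ℤ) : ZMod (gkMod r a k)))
    rw [wmap_eq_iff, gkMod_cast h2] at hux
    obtain ⟨t, ht⟩ := dvd_sub (dvd_gkWts_sub r a k u) hux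
    have hd : dd r a (Function.update u k (u k + t)) = r * u k + x % r := by
      rw [dd_update]; linear_combination -ht
    refine ⟨Function.update u k (u k + t), ?_, ?_⟩
    · have h0 := Int.emod_nonneg x hr'.ne'
      have hlt := Int.emod_lt_of_pos x hr'
      have hphi : phiRD r a k (Function.update u k (u k + t)) = u :=
        (phiRD_eq_iff hr k _ _).2 ⟨fun i hi => by simp [hi], by linarith, by linarith⟩
      simpa [hphi] using hu
    · rw [hw, hd]
      simp

/-- part of Proposition 4.4: if `Γ′` is a `G_k`-prebrick, then
`Γ = φ_k⁻¹(Γ′)` is a `G`-prebrick for `G` of type `(1/r)(1, a, r−a)`. -/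
theorem preimage_prebrick (r a : ℕ) (h1 : 0 < a) (h2 : a < r) (hcop : Nat.Coprime r a)
    (k : Fin 3) (Γ' : Set V3) (h' : IsPrebrick (gkMod r a k) (gkWts r a k) Γ') :
    IsPrebrick r (wtsG r a) (phiRD r a k ⁻¹' Γ') := by
  refine ⟨?_, bijOn_preimage h1 h2 k h'.bijOn, fun m hm n n' hn hn' hmem => ?_,
    fun m hm => preimage_connected h1 h2 k (Γ' := Γ') hm (h'.connected _ hm) m rfl⟩
  · simpa [phiRD_zero] using h'.zero_mem
  · have h := h'.saturated _ hm _ _ (phiRD_mono h2 k hn m) (phiRD_mono h2 k hn' (n + m))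
    simp only [Set.mem_preimage, add_assoc, sub_add_cancel] at h hmem ⊢
    exact h hmem
end
end

section
/- Let G be the cyclic group of type (1/r)(1, a, r−a) with gcd(r, a) = 1. Then Γ := { i·e₁ : 0 ≤ i ≤ r−1 } ⊆ ℤ³ is a G-brick, and S(Γ) = { n ∈ ℤ³ : r ∣ d(n), n₂ ≥ 0, n₃ ≥ 0, d(n) ≥ 0 }, where d(n) = n₁ + a·n₂ + (r−a)·n₃. (This set is σ∨ ∩ M for the cone σ = Cone(v, e₂, e₃) with v = (1/r)(1, a, r−a).) -/
noncomputable section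

open Classical

/-- The set `Γ = {1, x, x², …, x^{r−1}}`. -/
def GammaX (r : ℕ) : Set V3 := {m | ∃ i : ℕ, i < r ∧ m = (i : ℤ) • ee 0}

theorem wmap_wtsG (r a : ℕ) (m : V3) : wmap r (wtsG r a) m = (dd r a m : ZMod r) := by
  simp [wmap, wtsG, dd, Fin.sum_univ_three]

theorem wmap_wtsG_eq_iff (r a : ℕ) (m n : V3) :
    wmap r (wtsG r a) m = wmap r (wtsG r a) n ↔ dd r a m % r = dd r a n % r := by
  rw [wmap_wtsG, wmap_wtsG]
  exact ZMod.intCast_eq_intCast_iff' _ _ _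

theorem mem_GammaX_iff {r : ℕ} {m : V3} :
    m ∈ GammaX r ↔ 0 ≤ m 0 ∧ m 0 < r ∧ m 1 = 0 ∧ m 2 = 0 := by
  constructor
  · rintro ⟨i, hi, rfl⟩
    simp [ee, hi]
  · rintro ⟨h0, hr, hm1, hm2⟩
    refine ⟨(m 0).toNat, by omega, ?_⟩
    ext j
    fin_cases j <;> simp [ee, hm1, hm2, h0]

theorem dd_of_mem_GammaX {r : ℕ} (a : ℕ) {m : V3} (hm : m ∈ GammaX r) : dd r a m = m 0 := by
  obtain ⟨-, -, hm1, hm2⟩ := mem_GammaX_iff.1 hm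
  simp [dd, hm1, hm2]

theorem emod_smul_mem_GammaX {r : ℕ} (hr : 0 < r) (k : ℤ) : (k % r) • ee 0 ∈ GammaX r := by
  have hpos : (0 : ℤ) < r := by exact_mod_cast hr
  rw [mem_GammaX_iff]
  simp [ee, Int.emod_nonneg k hpos.ne', Int.emod_lt_of_pos k hpos]

theorem dd_emod_smul (r a : ℕ) (k : ℤ) : dd r a ((k % r) • ee 0) = k % r := by
  simp [dd, ee]

theorem injOn_wmap_GammaX (r a : ℕ) : Set.InjOn (wmap r (wtsG r a)) (GammaX r) := by
  intro m hm n hn h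
  rw [wmap_wtsG_eq_iff, dd_of_mem_GammaX a hm, dd_of_mem_GammaX a hn] at h
  obtain ⟨hm0, hmr, hm1, hm2⟩ := mem_GammaX_iff.1 hm
  obtain ⟨hn0, hnr, hn1, hn2⟩ := mem_GammaX_iff.1 hn
  rw [Int.emod_eq_of_lt hm0 hmr, Int.emod_eq_of_lt hn0 hnr] at h
  ext j
  fin_cases j <;> simp [h, hm1, hm2, hn1, hn2]

/-- The element of `Γ = {1, x, …, x^{r−1}}` of the same weight as `m` is `x^{d(m) mod r}`. -/
theorem wtG_GammaX {r : ℕ} (a : ℕ) (hr : 0 < r) (m : V3) :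
    wtG r (wtsG r a) (GammaX r) m = (dd r a m % r) • ee 0 := by
  have hex : (dd r a m % r) • ee 0 ∈ GammaX r ∧
      wmap r (wtsG r a) ((dd r a m % r) • ee 0) = wmap r (wtsG r a) m :=
    ⟨emod_smul_mem_GammaX hr _, by rw [wmap_wtsG_eq_iff, dd_emod_smul, Int.emod_emod]⟩
  have hspec := Classical.epsilon_spec
    (p := fun g => g ∈ GammaX r ∧ wmap r (wtsG r a) g = wmap r (wtsG r a) m) ⟨_, hex⟩
  exact injOn_wmap_GammaX r a hspec.1 hex.1 (hspec.2.trans hex.2.symm)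

theorem isPrebrick_GammaX {r : ℕ} (a : ℕ) (hr : 0 < r) :
    IsPrebrick r (wtsG r a) (GammaX r) where
  zero_mem := ⟨0, hr, by simp⟩
  bijOn := by
    refine ⟨Set.mapsTo_univ _ _, injOn_wmap_GammaX r a, fun c _ => ?_⟩
    obtain ⟨k, rfl⟩ := ZMod.intCast_surjective c
    refine ⟨(k % r) • ee 0, emod_smul_mem_GammaX hr k, ?_⟩
    rw [wmap_wtsG, dd_emod_smul]
    simp
  saturated := by
    intro m hm n n' hn hn' h
    rw [mem_GammaX_iff] at hm h ⊢
    simp only [Pi.add_apply] at h ⊢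
    have := hn 0
    have := hn 1
    have := hn 2
    have := hn' 0
    have := hn' 1
    have := hn' 2
    omega
  connected := by
    rintro m ⟨i, hi, rfl⟩
    induction i with
    | zero => simpa using Relation.ReflTransGen.refl
    | succ i ih =>
      refine Relation.ReflTransGen.head ⟨⟨i, by omega, rfl⟩, 0, Or.inr ?_⟩ (ih (by omega))
      push_cast
      module

theorem SG_GammaX {r a : ℕ} (h1 : 0 < a) (h2 : a < r) :
    (SG r (wtsG r a) (GammaX r) : Set V3) =
      {n : V3 | (r : ℤ) ∣ dd r a n ∧ 0 ≤ n 1 ∧ 0 ≤ n 2 ∧ 0 ≤ dd r a n} := by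
  have hr : 0 < r := h1.trans h2
  have hgen : ∀ n : V3, IsNat3 n →
      n - (dd r a n % r) • ee 0 ∈ SG r (wtsG r a) (GammaX r) := fun n hn =>
    AddSubmonoid.subset_closure
      ⟨n, 0, hn, (isPrebrick_GammaX a hr).zero_mem, by rw [wtG_GammaX a hr, add_zero]⟩
  ext v
  simp only [SetLike.mem_coe, Set.mem_ofPred_eq]
  constructor
  · intro hv
    induction hv using AddSubmonoid.closure_induction with
    | mem v hv =>
      obtain ⟨n, m, hn, hm, rfl⟩ := hv
      obtain ⟨hm0, -, hm1, hm2⟩ := mem_GammaX_iff.1 hm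
      have hra : (0 : ℤ) ≤ r - a := by omega
      have hd : 0 ≤ dd r a (n + m) := by
        rw [dd_add, dd_of_mem_GammaX a hm]
        have := hn 0
        have := mul_nonneg (Int.natCast_nonneg a) (hn 1)
        have := mul_nonneg hra (hn 2)
        simp only [dd]
        omega
      have hsub : dd r a (n + m - (dd r a (n + m) % r) • ee 0) =
          r * (dd r a (n + m) / r) := by
        have hsplit := dd_add r a (n + m - (dd r a (n + m) % r) • ee 0)
          ((dd r a (n + m) % r) • ee 0)
        rw [sub_add_cancel, dd_emod_smul] at hsplit
        linarith [Int.mul_ediv_add_emod (dd r a (n + m)) r]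
      rw [wtG_GammaX a hr, hsub]
      refine ⟨dvd_mul_right _ _, ?_, ?_, by positivity⟩
      · simpa [ee, hm1] using hn 1
      · simpa [ee, hm2] using hn 2
    | zero => simp [dd]
    | add u v _ _ hu hv =>
      rw [dd_add]
      exact ⟨dvd_add hu.1 hv.1, add_nonneg hu.2.1 hv.2.1, add_nonneg hu.2.2.1 hv.2.2.1,
        add_nonneg hu.2.2.2 hv.2.2.2⟩
  · rintro ⟨⟨k, hk⟩, hv1, hv2, hd⟩
    have hk0 : 0 ≤ k := by
      rw [hk] at hd
      exact nonneg_of_mul_nonneg_right hd (by exact_mod_cast hr)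
    have hx : (r : ℤ) • ee 0 ∈ SG r (wtsG r a) (GammaX r) := by
      have h := hgen ((r : ℤ) • ee 0) (fun j => by fin_cases j <;> simp [ee])
      simpa [dd, ee] using h
    have hy : ee 1 - (a : ℤ) • ee 0 ∈ SG r (wtsG r a) (GammaX r) := by
      have h := hgen (ee 1) (fun j => by fin_cases j <;> simp [ee])
      have hmod : dd r a (ee 1) % r = a := by
        rw [show dd r a (ee 1) = a by simp [dd, ee]]
        exact Int.emod_eq_of_lt (by omega) (by omega)
      rwa [hmod] at h
    have hz : ee 2 - ((r : ℤ) - a) • ee 0 ∈ SG r (wtsG r a) (GammaX r) := by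
      have h := hgen (ee 2) (fun j => by fin_cases j <;> simp [ee])
      have hmod : dd r a (ee 2) % r = r - a := by
        rw [show dd r a (ee 2) = r - a by simp [dd, ee]]
        exact Int.emod_eq_of_lt (by omega) (by omega)
      rwa [hmod] at h
    have hv : v = k.toNat • ((r : ℤ) • ee 0) + (v 1).toNat • (ee 1 - (a : ℤ) • ee 0) +
        (v 2).toNat • (ee 2 - ((r : ℤ) - a) • ee 0) := by
      have hv0 : v 0 = r * k - a * v 1 - (r - a) * v 2 := by
        rw [← hk, dd]
        ring
      ext j
      fin_cases j
      · simp [ee, hk0, hv1, hv2, hv0]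
        ring
      · simp [ee, hv1]
      · simp [ee, hv2]
    rw [hv]
    exact add_mem (add_mem (nsmul_mem hx _) (nsmul_mem hy _)) (nsmul_mem hz _)

/-- Case (1) in Proposition 4.7: `Γ = {1, x, …, x^{r−1}}` is a
`G`-brick for `G` of type `(1/r)(1, a, r−a)`, and `S(Γ) = σ∨ ∩ M` for
`σ = Cone(v, e₂, e₃)`, i.e. `S(Γ) = { n ∈ M : n₂ ≥ 0, n₃ ≥ 0, d(n) ≥ 0 }`. -/
theorem gammaX_brick (r a : ℕ) (h1 : 0 < a) (h2 : a < r) (hcop : Nat.Coprime r a) :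
    IsBrick r (wtsG r a) (GammaX r) ∧
      (SG r (wtsG r a) (GammaX r) : Set V3) =
        {n : V3 | (r : ℤ) ∣ dd r a n ∧ 0 ≤ n 1 ∧ 0 ≤ n 2 ∧ 0 ≤ dd r a n} := by
  have hS := SG_GammaX h1 h2
  refine ⟨⟨isPrebrick_GammaX a (h1.trans h2), fun v hv hneg => ?_⟩, hS⟩
  rw [← SetLike.mem_coe, hS] at hv hneg
  obtain ⟨-, hv1, hv2, hd⟩ := hv
  obtain ⟨-, hn1, hn2, hnd⟩ := hneg
  have hz1 : v 1 = 0 := le_antisymm (by simpa using hn1) hv1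
  have hz2 : v 2 = 0 := le_antisymm (by simpa using hn2) hv2
  simp only [dd, Pi.neg_apply, hz1, hz2, mul_zero, neg_zero, add_zero] at hd hnd
  ext j
  fin_cases j
  · exact le_antisymm (by simpa using hnd) hd
  · exact hz1
  · exact hz2
end
end

section
/- Let r ≥ 2 and let G be the cyclic group of type (1/r)(1, r−1, 1), i.e. weight map w(m) = m₁ + (r−1)m₂ + m₃ (mod r) with invariant lattice M = ker w. Set v₀ = (0, r, 0), v_r = (0, 0, r), and v_j = (j, r−j, j) for 1 ≤ j ≤ r−1, and write ⟨v, n⟩ = v₁n₁ + v₂n₂ + v₃n₃. For 1 ≤ i ≤ r put Γ_i := { j·e₂ : 0 ≤ j ≤ i−1 } ∪ { j·e₃ : 1 ≤ j ≤ r−i }, and for 1 ≤ i ≤ r−1 put Γ_{r+i} := { j·e₂ : 0 ≤ j ≤ i−1 } ∪ { j·e₁ : 1 ≤ j ≤ r−i }. Then each Γ_i (1 ≤ i ≤ r) is a G-brick with S(Γ_i) = { n ∈ M : n₁ ≥ 0, ⟨v_{i−1}, n⟩ ≥ 0, ⟨v_i, n⟩ ≥ 0 }, and each Γ_{r+i}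 (1 ≤ i ≤ r−1) is a G-brick with S(Γ_{r+i}) = { n ∈ M : n₃ ≥ 0, ⟨v_{i−1}, n⟩ ≥ 0, ⟨v_i, n⟩ ≥ 0 }. -/
noncomputable section

open Classical

/-- The lattice points `v₀ = (0,r,0)`, `v_j = (j, r−j, j)` for `1 ≤ j ≤ r−1`,
and `v_r = (0,0,r)`. -/
def vLat (r : ℕ) (j : ℕ) : V3 :=
  if j = r then ![0, 0, (r : ℤ)] else ![(j : ℤ), (r : ℤ) - (j : ℤ), (j : ℤ)]

/-- The pairing `⟨v, n⟩ = v₁n₁ + v₂n₂ + v₃n₃`. -/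
def pair (v n : V3) : ℤ := v 0 * n 0 + v 1 * n 1 + v 2 * n 2

/-- `Γ_i = {1, y, …, y^{i−1}, z, …, z^{r−i}}` for `1 ≤ i ≤ r`. -/
def GammaYZ (r i : ℕ) : Set V3 :=
  {m | ∃ j : ℕ, j < i ∧ m = (j : ℤ) • ee 1} ∪
    {m | ∃ j : ℕ, 1 ≤ j ∧ j ≤ r - i ∧ m = (j : ℤ) • ee 2}

/-- `Γ_{r+i} = {1, y, …, y^{i−1}, x, …, x^{r−i}}` for `1 ≤ i ≤ r−1`. -/
def GammaYX (r i : ℕ) : Set V3 :=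
  {m | ∃ j : ℕ, j < i ∧ m = (j : ℤ) • ee 1} ∪
    {m | ∃ j : ℕ, 1 ≤ j ∧ j ≤ r - i ∧ m = (j : ℤ) • ee 0}

/-- The monomials `1, y, …, y^{i−1}` and `t, …, t^{r−i}`, where `t` is the `p`-th variable. -/
def axisBrick (p : Fin 3) (r i : ℕ) : Set V3 :=
  {m | ∃ j : ℕ, j < i ∧ m = (j : ℤ) • ee 1} ∪
    {m | ∃ j : ℕ, 1 ≤ j ∧ j ≤ r - i ∧ m = (j : ℤ) • ee p}

/-- `p` and `q` are the indices of the variables `x` and `z`, in some order. -/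
def IsXZPair (p q : Fin 3) : Prop := (p = 2 ∧ q = 0) ∨ (p = 0 ∧ q = 2)

theorem IsXZPair.ext_iff {p q : Fin 3} (h : IsXZPair p q) {m n : V3} :
    m = n ↔ m p = n p ∧ m 1 = n 1 ∧ m q = n q := by
  rw [funext_iff, Fin.forall_fin_succ, Fin.forall_fin_succ, Fin.forall_fin_succ]
  rcases h with ⟨rfl, rfl⟩ | ⟨rfl, rfl⟩ <;> simp <;> tauto

theorem IsXZPair.isNat3_iff {p q : Fin 3} (h : IsXZPair p q) {m : V3} :
    IsNat3 m ↔ 0 ≤ m p ∧ 0 ≤ m 1 ∧ 0 ≤ m q := by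
  unfold IsNat3
  rw [Fin.forall_fin_succ, Fin.forall_fin_succ, Fin.forall_fin_succ]
  rcases h with ⟨rfl, rfl⟩ | ⟨rfl, rfl⟩ <;> simp <;> tauto

theorem IsXZPair.wmap_eq_intCast {p q : Fin 3} (h : IsXZPair p q) (r : ℕ) (m : V3) :
    wmap r ![1, (r : ℤ) - 1, 1] m = ((m p - m 1 + m q : ℤ) : ZMod r) := by
  rcases h with ⟨rfl, rfl⟩ | ⟨rfl, rfl⟩ <;> simp [wmap, Fin.sum_univ_three] <;> ring

theorem IsXZPair.wmap_eq_iff {p q : Fin 3} (h : IsXZPair p q) {r : ℕ} {m n : V3} :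
    wmap r ![1, (r : ℤ) - 1, 1] m = wmap r ![1, (r : ℤ) - 1, 1] n ↔
      (r : ℤ) ∣ (n p - n 1 + n q) - (m p - m 1 + m q) := by
  rw [h.wmap_eq_intCast, h.wmap_eq_intCast, ZMod.intCast_eq_intCast_iff_dvd_sub]

theorem IsXZPair.wmap_eq_zero_iff {p q : Fin 3} (h : IsXZPair p q) {r : ℕ} {m : V3} :
    wmap r ![1, (r : ℤ) - 1, 1] m = 0 ↔ (r : ℤ) ∣ m p - m 1 + m q := by
  rw [h.wmap_eq_intCast, ZMod.intCast_zmod_eq_zero_iff_dvd]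

theorem IsXZPair.smul_ee_apply {p q : Fin 3} (h : IsXZPair p q) (c : ℤ) :
    ((c • ee 1) p = 0 ∧ (c • ee 1) 1 = c ∧ (c • ee 1) q = 0) ∧
    ((c • ee p) p = c ∧ (c • ee p) 1 = 0 ∧ (c • ee p) q = 0) ∧
    ((c • ee q) p = 0 ∧ (c • ee q) 1 = 0 ∧ (c • ee q) q = c) := by
  rcases h with ⟨rfl, rfl⟩ | ⟨rfl, rfl⟩ <;> simp [ee]

theorem nsmul_sub_apply (c : ℕ) (u v : V3) (k : Fin 3) :
    (c • (u - v)) k = (c : ℤ) * (u k - v k) := by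
  simp

theorem IsXZPair.mem_axisBrick {p q : Fin 3} (h : IsXZPair p q) {r i : ℕ} (hir : i ≤ r)
    {m : V3} :
    m ∈ axisBrick p r i ↔ m q = 0 ∧ ((m p = 0 ∧ 0 ≤ m 1 ∧ m 1 < i) ∨
      (m 1 = 0 ∧ 1 ≤ m p ∧ m p ≤ (r : ℤ) - i)) := by
  constructor
  · rintro (⟨j, hj, rfl⟩ | ⟨j, hj, hj', rfl⟩)
    · obtain ⟨⟨h1, h2, h3⟩, -⟩ := h.smul_ee_apply j
      rw [h1, h2, h3]; omega
    · obtain ⟨-, ⟨h1, h2, h3⟩, -⟩ := h.smul_ee_apply j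
      rw [h1, h2, h3]; omega
  · rintro ⟨hq, ⟨hp, h0, hi⟩ | ⟨h1, hp, hi⟩⟩
    · refine Or.inl ⟨(m 1).toNat, by omega, h.ext_iff.2 ?_⟩
      obtain ⟨⟨h1, h2, h3⟩, -⟩ := h.smul_ee_apply ((m 1).toNat : ℤ)
      rw [h1, h2, h3]; omega
    · refine Or.inr ⟨(m p).toNat, by omega, by omega, h.ext_iff.2 ?_⟩
      obtain ⟨-, ⟨h1, h2, h3⟩, -⟩ := h.smul_ee_apply ((m p).toNat : ℤ)
      rw [h1, h2, h3]; omega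

theorem reflTransGen_stepRel_smul_ee {Γ : Set V3} (k : Fin 3) (j : ℕ)
    (hΓ : ∀ t : ℕ, t < j → (t : ℤ) • ee k ∈ Γ) :
    Relation.ReflTransGen (StepRel Γ) ((j : ℤ) • ee k) 0 := by
  induction j with
  | zero => simpa using Relation.ReflTransGen.refl
  | succ j ih =>
    refine Relation.ReflTransGen.head ⟨hΓ j (by omega), k, Or.inr ?_⟩
      (ih fun t ht => hΓ t (by omega))
    push_cast
    rw [add_smul, one_smul, add_sub_cancel_right]

theorem IsXZPair.isPrebrick_axisBrick {p q : Fin 3} (h : IsXZPair p q) {r i : ℕ}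
    (hi : 1 ≤ i) (hir : i ≤ r) :
    IsPrebrick r ![1, (r : ℤ) - 1, 1] (axisBrick p r i) where
  zero_mem := by
    rw [h.mem_axisBrick hir]; simp; omega
  bijOn := by
    refine ⟨fun _ _ => Set.mem_univ _, ?_, ?_⟩
    · intro m hm n hn hmn
      rw [h.mem_axisBrick hir] at hm hn
      have hd := Int.eq_zero_of_abs_lt_dvd (h.wmap_eq_iff.1 hmn) (by rw [abs_lt]; omega)
      rw [h.ext_iff]; omega
    · intro c _
      have : NeZero r := ⟨by omega⟩
      have hc := c.val_lt
      by_cases hci : c.val ≤ r - i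
      · obtain ⟨-, ⟨h1, h2, h3⟩, -⟩ := h.smul_ee_apply (c.val : ℤ)
        refine ⟨(c.val : ℤ) • ee p, (h.mem_axisBrick hir).2 (by rw [h1, h2, h3]; omega), ?_⟩
        rw [h.wmap_eq_intCast, h1, h2, h3]; simp
      · obtain ⟨⟨h1, h2, h3⟩, -⟩ := h.smul_ee_apply ((r : ℤ) - c.val)
        refine ⟨((r : ℤ) - c.val) • ee 1,
          (h.mem_axisBrick hir).2 (by rw [h1, h2, h3]; omega), ?_⟩
        rw [h.wmap_eq_intCast, h1, h2, h3]; simp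
  saturated := by
    intro m hm n n' hn hn' hs
    rw [h.mem_axisBrick hir] at hm hs ⊢
    rw [h.isNat3_iff] at hn hn'
    simp only [Pi.add_apply] at hs ⊢
    omega
  connected := by
    rintro m (⟨j, hj, rfl⟩ | ⟨j, hj, hj', rfl⟩)
    · exact reflTransGen_stepRel_smul_ee 1 j fun t ht => Or.inl ⟨t, by omega, rfl⟩
    · refine reflTransGen_stepRel_smul_ee p j fun t ht => ?_
      rcases Nat.eq_zero_or_pos t with rfl | ht0
      · exact Or.inl ⟨0, by omega, by simp⟩
      · exact Or.inr ⟨t, ht0, by omega, rfl⟩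

theorem IsPrebrick.wtG_spec {s : ℕ} {β : Fin 3 → ℤ} {Γ : Set V3} (hΓ : IsPrebrick s β Γ)
    (m : V3) : wtG s β Γ m ∈ Γ ∧ wmap s β (wtG s β Γ m) = wmap s β m :=
  Classical.epsilon_spec (p := fun g => g ∈ Γ ∧ wmap s β g = wmap s β m)
    (hΓ.bijOn.surjOn (Set.mem_univ (wmap s β m)))

theorem IsPrebrick.sub_mem_SG {s : ℕ} {β : Fin 3 → ℤ} {Γ : Set V3} (hΓ : IsPrebrick s β Γ)
    {n g : V3} (hn : IsNat3 n) (hg : g ∈ Γ) (hw : wmap s β g = wmap s β n) :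
    n - g ∈ SG s β Γ := by
  refine AddSubmonoid.subset_closure ⟨n, 0, hn, hΓ.zero_mem, ?_⟩
  obtain ⟨h1, h2⟩ := hΓ.wtG_spec n
  rw [add_zero, hΓ.bijOn.injOn hg h1 (hw.trans h2.symm)]

/-- A prebrick of genuine monomials whose monoid is a salient monoid `C` is a brick. -/
theorem IsPrebrick.isBrick_and_SG_eq {s : ℕ} {β : Fin 3 → ℤ} {Γ : Set V3}
    (hΓ : IsPrebrick s β Γ) (hnat : ∀ m ∈ Γ, IsNat3 m) {C : Set V3} (hC0 : 0 ∈ C)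
    (hCadd : ∀ u ∈ C, ∀ v ∈ C, u + v ∈ C)
    (hsub : ∀ n g, IsNat3 n → g ∈ Γ → wmap s β g = wmap s β n → n - g ∈ C)
    (hle : ∀ v ∈ C, v ∈ SG s β Γ) (hsal : ∀ v ∈ C, -v ∈ C → v = 0) :
    IsBrick s β Γ ∧ (SG s β Γ : Set V3) = C := by
  have hSC : ∀ v ∈ SG s β Γ, v ∈ C := by
    intro v hv
    induction hv using AddSubmonoid.closure_induction with
    | mem v hv =>
      obtain ⟨n, m, hn, hm, rfl⟩ := hv
      obtain ⟨h1, h2⟩ := hΓ.wtG_spec (n + m)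
      exact hsub _ _ (fun k => add_nonneg (hn k) (hnat m hm k)) h1 h2
    | zero => exact hC0
    | add u v _ _ hu hv => exact hCadd u hu v hv
  exact ⟨⟨hΓ, fun v hv hv' => hsal v (hSC v hv) (hSC _ hv')⟩,
    Set.Subset.antisymm hSC hle⟩

theorem IsXZPair.isNat3_of_mem_axisBrick {p q : Fin 3} (h : IsXZPair p q) {r i : ℕ}
    (hir : i ≤ r) : ∀ m ∈ axisBrick p r i, IsNat3 m := by
  intro m hm
  rw [h.mem_axisBrick hir] at hm
  rw [h.isNat3_iff]; omega

/-- Among the monomials of a given weight, the elements of `axisBrick p r i` minimise the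
pairing with `(j, r - j, j)` for `j = i - 1` and `j = i`. -/
theorem IsXZPair.weighted_degree_le {p q : Fin 3} (h : IsXZPair p q) {r i : ℕ} (hir : i ≤ r)
    {j : ℤ} (hj : (i : ℤ) - 1 ≤ j) (hji : j ≤ i) (hj0 : 0 ≤ j) {n g : V3} (hn : IsNat3 n)
    (hg : g ∈ axisBrick p r i)
    (hw : wmap r ![1, (r : ℤ) - 1, 1] g = wmap r ![1, (r : ℤ) - 1, 1] n) :
    j * (g p + g q) + (r - j) * g 1 ≤ j * (n p + n q) + (r - j) * n 1 := by
  rw [h.mem_axisBrick hir] at hg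
  rw [h.isNat3_iff] at hn
  obtain ⟨k, hk⟩ := h.wmap_eq_iff.1 hw
  obtain ⟨hnp, hn1, hnq⟩ := hn
  obtain ⟨hgq, hg⟩ := hg
  have hr0 : (0 : ℤ) ≤ r - j := by omega
  have hr : (0 : ℤ) ≤ r := by omega
  -- the difference of the two sides, written in two ways
  have e1 : j * (n p + n q) + (r - j) * n 1 - (j * (g p + g q) + (r - j) * g 1)
      = r * (j * k + n 1 - g 1) := by linear_combination j * hk
  have e2 : j * (n p + n q) + (r - j) * n 1 - (j * (g p + g q) + (r - j) * g 1)
      = r * ((n p + n q) - (g p + g q) - (r - j) * k) := by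
    linear_combination (j - r) * hk
  rw [← sub_nonneg]
  rcases le_or_gt k 0 with hk0 | hk0
  · rcases eq_or_lt_of_le hk0 with rfl | hk1
    · rcases hg with hg | hg
      · rw [e2]; apply mul_nonneg hr; omega
      · rw [e1]; apply mul_nonneg hr; omega
    · rw [e2]; apply mul_nonneg hr
      have : 0 ≤ (r - j) * (-1 - k) := mul_nonneg hr0 (by omega)
      have : (r - j) * (-1 - k) = -(r - j) - (r - j) * k := by ring
      omega
  · rw [e1]; apply mul_nonneg hr
    have : 0 ≤ j * (k - 1) := mul_nonneg hj0 (by omega)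
    have : j * (k - 1) = j * k - j := by ring
    omega

theorem IsXZPair.brick_of_lt {p q : Fin 3} (h : IsXZPair p q) {r i : ℕ}
    (hi : 1 ≤ i) (hir : i < r) :
    IsBrick r ![1, (r : ℤ) - 1, 1] (axisBrick p r i) ∧
      (SG r ![1, (r : ℤ) - 1, 1] (axisBrick p r i) : Set V3) =
        {n : V3 | wmap r ![1, (r : ℤ) - 1, 1] n = 0 ∧ 0 ≤ n q ∧
          0 ≤ pair (vLat r (i - 1)) n ∧ 0 ≤ pair (vLat r i) n} := by
  have hΓ := h.isPrebrick_axisBrick hi hir.le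
  have hr0 : (0 : ℤ) < r := by omega
  have hv : ∀ j : ℕ, j < r → ∀ n : V3,
      pair (vLat r j) n = (j : ℤ) * (n p + n q) + (r - j) * n 1 := by
    intro j hj n
    rcases h with ⟨rfl, rfl⟩ | ⟨rfl, rfl⟩ <;> simp [pair, vLat, hj.ne] <;> ring
  have hcast : ((i - 1 : ℕ) : ℤ) = i - 1 := by omega
  simp only [hv (i - 1) (by omega), hv i hir, h.wmap_eq_zero_iff, hcast]
  refine hΓ.isBrick_and_SG_eq (h.isNat3_of_mem_axisBrick hir.le) (by simp) ?_ ?_ ?_ ?_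
  · rintro u ⟨hu, hu0, hu1, hu2⟩ v ⟨hv, hv0, hv1, hv2⟩
    simp only [Set.mem_ofPred_eq, Pi.add_apply]
    refine ⟨?_, by omega, by linarith, by linarith⟩
    convert Int.dvd_add hu hv using 1; ring
  · intro n g hn hg hw
    have h1 := h.weighted_degree_le hir.le (j := i - 1) le_rfl (by omega) (by omega) hn hg hw
    have h2 := h.weighted_degree_le hir.le (j := i) (by omega) le_rfl (by omega) hn hg hw
    have h3 := h.wmap_eq_iff.1 hw
    rw [h.mem_axisBrick hir.le] at hg
    rw [h.isNat3_iff] at hn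
    simp only [Set.mem_ofPred_eq, Pi.sub_apply]
    refine ⟨?_, by omega, by linarith, by linarith⟩
    convert h3 using 1; ring
  · rintro v ⟨⟨k, hk⟩, hq, hA, hB⟩
    -- the coordinates of `v` in the basis dual to the two rays
    have ha : 0 ≤ (i - 1) * k + v 1 := by
      refine (mul_nonneg_iff_of_pos_left hr0).1 ?_
      linear_combination hA + ((i : ℤ) - 1) * hk
    have hb : 0 ≤ i * k + v 1 := by
      refine (mul_nonneg_iff_of_pos_left hr0).1 ?_
      linear_combination hB + (i : ℤ) * hk
    obtain ⟨a, ha⟩ := Int.eq_ofNat_of_zero_le ha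
    obtain ⟨b, hb⟩ := Int.eq_ofNat_of_zero_le hb
    obtain ⟨c, hc⟩ := Int.eq_ofNat_of_zero_le hq
    have key : v = c • ((1 : ℤ) • ee q - (1 : ℤ) • ee p)
        + a • ((i : ℤ) • ee 1 - ((r : ℤ) - i) • ee p)
        + b • (((r : ℤ) - i + 1) • ee p - ((i : ℤ) - 1) • ee 1) := by
      rw [h.ext_iff]
      simp only [Pi.add_apply, nsmul_sub_apply, h.smul_ee_apply, ← ha, ← hb, ← hc]
      refine ⟨?_, ?_, ?_⟩
      · linear_combination hk
      · ring
      · ring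
    rw [key]
    refine add_mem (add_mem (nsmul_mem (hΓ.sub_mem_SG (h.isNat3_iff.2 ?_)
      ((h.mem_axisBrick hir.le).2 ?_) (h.wmap_eq_iff.2 ?_)) _) (nsmul_mem (hΓ.sub_mem_SG
      (h.isNat3_iff.2 ?_) ((h.mem_axisBrick hir.le).2 ?_) (h.wmap_eq_iff.2 ?_)) _))
      (nsmul_mem (hΓ.sub_mem_SG (h.isNat3_iff.2 ?_) ((h.mem_axisBrick hir.le).2 ?_)
      (h.wmap_eq_iff.2 ?_)) _)
    all_goals simp only [h.smul_ee_apply, true_and, and_true, le_refl]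
    all_goals first | omega | exact ⟨0, by ring1⟩ | exact ⟨1, by ring1⟩ | exact ⟨-1, by ring1⟩
  · rintro v ⟨-, hq, hA, hB⟩ ⟨-, hq', hA', hB'⟩
    simp only [Pi.neg_apply] at hq' hA' hB'
    have h1 : v p + v q - v 1 = 0 := by linarith
    have h2 : (r : ℤ) * v 1 = 0 := by
      have : (i : ℤ) * (v p + v q) + (r - i) * v 1 = 0 := by linarith
      linear_combination this - i * h1
    have h3 : v 1 = 0 := (mul_eq_zero.1 h2).resolve_left hr0.ne'
    rw [h.ext_iff]; simp only [Pi.zero_apply]; omega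

theorem brick_axisBrick_self {r : ℕ} (hr : 1 ≤ r) :
    IsBrick r ![1, (r : ℤ) - 1, 1] (axisBrick 2 r r) ∧
      (SG r ![1, (r : ℤ) - 1, 1] (axisBrick 2 r r) : Set V3) =
        {n : V3 | wmap r ![1, (r : ℤ) - 1, 1] n = 0 ∧ 0 ≤ n 0 ∧
          0 ≤ pair (vLat r (r - 1)) n ∧ 0 ≤ pair (vLat r r) n} := by
  have h : IsXZPair 2 0 := Or.inl ⟨rfl, rfl⟩
  have hΓ := h.isPrebrick_axisBrick hr le_rfl
  have hr0 : (0 : ℤ) < r := by omega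
  have hv1 : ∀ n : V3, pair (vLat r (r - 1)) n = ((r : ℤ) - 1) * (n 2 + n 0) + n 1 := by
    intro n
    have : r - 1 ≠ r := by omega
    simp [pair, vLat, this, Nat.cast_sub hr]; ring
  have hv2 : ∀ n : V3, 0 ≤ pair (vLat r r) n ↔ 0 ≤ n 2 := by
    intro n
    simp [pair, vLat, mul_nonneg_iff_of_pos_left hr0]
  simp only [hv1, hv2, h.wmap_eq_zero_iff]
  refine hΓ.isBrick_and_SG_eq (h.isNat3_of_mem_axisBrick le_rfl) (by simp) ?_ ?_ ?_ ?_
  · rintro u ⟨hu, hu0, hu1, hu2⟩ v ⟨hv, hv0, hv1, hv2⟩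
    simp only [Set.mem_ofPred_eq, Pi.add_apply]
    refine ⟨?_, by omega, by linarith, by omega⟩
    convert Int.dvd_add hu hv using 1; ring
  · intro n g hn hg hw
    have h1 := h.weighted_degree_le le_rfl (j := r - 1) le_rfl (by omega) (by omega) hn hg hw
    have h3 := h.wmap_eq_iff.1 hw
    rw [h.mem_axisBrick le_rfl] at hg
    rw [h.isNat3_iff] at hn
    simp only [Set.mem_ofPred_eq, Pi.sub_apply]
    refine ⟨?_, by omega, by linarith, by omega⟩
    convert h3 using 1; ring
  · rintro v ⟨⟨k, hk⟩, hq, hA, hp⟩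
    have ha : 0 ≤ v 2 + v 0 - k := by
      refine (mul_nonneg_iff_of_pos_left hr0).1 ?_
      linear_combination hA - hk
    obtain ⟨a, ha⟩ := Int.eq_ofNat_of_zero_le ha
    obtain ⟨b, hb⟩ := Int.eq_ofNat_of_zero_le hp
    obtain ⟨c, hc⟩ := Int.eq_ofNat_of_zero_le hq
    have key : v = c • ((1 : ℤ) • ee 0 - ((r : ℤ) - 1) • ee 1)
        + b • ((1 : ℤ) • ee 2 - ((r : ℤ) - 1) • ee 1)
        + a • ((r : ℤ) • ee 1 - (0 : ℤ) • ee 1) := by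
      rw [h.ext_iff]
      simp only [Pi.add_apply, nsmul_sub_apply, h.smul_ee_apply, ← ha, ← hb, ← hc]
      refine ⟨?_, ?_, ?_⟩
      · ring
      · linear_combination -hk
      · ring
    rw [key]
    refine add_mem (add_mem (nsmul_mem (hΓ.sub_mem_SG (h.isNat3_iff.2 ?_)
      ((h.mem_axisBrick le_rfl).2 ?_) (h.wmap_eq_iff.2 ?_)) _) (nsmul_mem (hΓ.sub_mem_SG
      (h.isNat3_iff.2 ?_) ((h.mem_axisBrick le_rfl).2 ?_) (h.wmap_eq_iff.2 ?_)) _))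
      (nsmul_mem (hΓ.sub_mem_SG (h.isNat3_iff.2 ?_) ((h.mem_axisBrick le_rfl).2 ?_)
      (h.wmap_eq_iff.2 ?_)) _)
    all_goals simp only [h.smul_ee_apply, true_and, and_true, le_refl]
    all_goals first | omega | exact ⟨0, by ring1⟩ | exact ⟨1, by ring1⟩ | exact ⟨-1, by ring1⟩
  · rintro v ⟨-, hq, hA, hp⟩ ⟨-, hq', hA', hp'⟩
    simp only [Pi.neg_apply] at hq' hA' hp'
    have h0 : v 0 = 0 := by omega
    have h2 : v 2 = 0 := by omega
    rw [h.ext_iff]; simp only [Pi.zero_apply]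
    rw [h0, h2] at hA hA'
    exact ⟨h2, by linarith, h0⟩

/-- Section 4.1 of the paper, the case `(1/r)(1, r−1, 1)`:
the `2r−1` sets `Γ_i`, `Γ_{r+i}` are `G`-bricks with `S(Γ_j) = σ_j∨ ∩ M`. -/
theorem bricks_for_a_eq_r_sub_one (r : ℕ) (hr : 2 ≤ r) :
    (∀ i : ℕ, 1 ≤ i → i ≤ r →
      IsBrick r ![1, (r : ℤ) - 1, 1] (GammaYZ r i) ∧
        (SG r ![1, (r : ℤ) - 1, 1] (GammaYZ r i) : Set V3) =
          {n : V3 | wmap r ![1, (r : ℤ) - 1, 1] n = 0 ∧ 0 ≤ n 0 ∧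
            0 ≤ pair (vLat r (i - 1)) n ∧ 0 ≤ pair (vLat r i) n}) ∧
    (∀ i : ℕ, 1 ≤ i → i ≤ r - 1 →
      IsBrick r ![1, (r : ℤ) - 1, 1] (GammaYX r i) ∧
        (SG r ![1, (r : ℤ) - 1, 1] (GammaYX r i) : Set V3) =
          {n : V3 | wmap r ![1, (r : ℤ) - 1, 1] n = 0 ∧ 0 ≤ n 2 ∧
            0 ≤ pair (vLat r (i - 1)) n ∧ 0 ≤ pair (vLat r i) n}) := by
  refine ⟨fun i hi hir => ?_, fun i hi hir => ?_⟩
  · rcases hir.eq_or_lt with rfl | hlt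
    · exact brick_axisBrick_self hi
    · exact IsXZPair.brick_of_lt (Or.inl ⟨rfl, rfl⟩) hi hlt
  · exact IsXZPair.brick_of_lt (Or.inr ⟨rfl, rfl⟩) hi (by omega)
end
end
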